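/- For every valid online translation strategy σ and every integer n ≥ 1, there exists a stream L of n² + 1 pieces, each of whose two edge lengths is at least 1, such that OPT(L) ≤ 2n² and ALG_σ(L) ≥ n³, where the cost is the area of the bounding box. In particular, any competitive ratio of an online algorithm for area minimization with translations only, expressed as a function of OPT, is Ω(√OPT), even when all edges have length at least 1. -/

import Mathlib

open Set

/-- A piece is a pair (w,h) of (intended positive) real numbers. -/
abbrev Piece := ℝ × ℝ

/-- Both edge lengths of the piece are positive. -/
def PiecePos (p : Piece) : Prop := 0 < p.1 ∧ 0 < p.2

/-- The axis-parallel closed rectangle obtained by placing piece `p` by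
translation at the point `q`. -/
def placedRect (p : Piece) (q : ℝ × ℝ) : Set (ℝ × ℝ) :=
  Set.Icc q.1 (q.1 + p.1) ×ˢ Set.Icc q.2 (q.2 + p.2)

/-- Width of the axis-parallel bounding box of a set in the plane. -/
noncomputable def boxWidth (S : Set (ℝ × ℝ)) : ℝ :=
  sSup (Prod.fst '' S) - sInf (Prod.fst '' S)

/-- Height of the axis-parallel bounding box of a set in the plane. -/
noncomputable def boxHeight (S : Set (ℝ × ℝ)) : ℝ :=
  sSup (Prod.snd '' S) - sInf (Prod.snd '' S)

/-! ### Translations only -/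

/-- `pos` is a packing (by translations) of the list `L` of pieces:
the placed rectangles have pairwise disjoint interiors. -/
def IsPacking (L : List Piece) (pos : Fin L.length → ℝ × ℝ) : Prop :=
  ∀ i j : Fin L.length, i ≠ j →
    Disjoint (interior (placedRect (L.get i) (pos i)))
             (interior (placedRect (L.get j) (pos j)))

/-- The union of the placed rectangles. -/
def packedSet (L : List Piece) (pos : Fin L.length → ℝ × ℝ) : Set (ℝ × ℝ) :=
  ⋃ i : Fin L.length, placedRect (L.get i) (pos i)

/-- Perimeter of the bounding box of a packing. -/
noncomputable def periCost (L : List Piece) (pos : Fin L.length → ℝ × ℝ) : ℝ :=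
  2 * (boxWidth (packedSet L pos) + boxHeight (packedSet L pos))

/-- Area of the bounding box of a packing. -/
noncomputable def areaCost (L : List Piece) (pos : Fin L.length → ℝ × ℝ) : ℝ :=
  boxWidth (packedSet L pos) * boxHeight (packedSet L pos)

/-- Optimal offline bounding-box perimeter for the pieces of `L`. -/
noncomputable def optPeri (L : List Piece) : ℝ :=
  sInf { c | ∃ pos : Fin L.length → ℝ × ℝ, IsPacking L pos ∧ periCost L pos = c }

/-- Optimal offline bounding-box area for the pieces of `L`. -/
noncomputable def optArea (L : List Piece) : ℝ :=
  sInf { c | ∃ pos : Fin L.length → ℝ × ℝ, IsPacking L pos ∧ areaCost L pos = c }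

/-- The positions chosen by the online strategy `σ` on the stream `L`:
the `i`-th piece is placed at the point chosen by `σ` as a function of the
first `i+1` pieces. -/
def onlinePos (σ : List Piece → ℝ × ℝ) (L : List Piece) :
    Fin L.length → ℝ × ℝ :=
  fun i => σ (L.take ((i : ℕ) + 1))

/-- `σ` is a valid online translation strategy: on every stream of pieces it
produces a packing. -/
def StrategyValid (σ : List Piece → ℝ × ℝ) : Prop :=
  ∀ L : List Piece, (∀ p ∈ L, PiecePos p) → IsPacking L (onlinePos σ L)

/-- Perimeter of the bounding box of the packing produced by `σ` on `L`. -/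
noncomputable def algPeri (σ : List Piece → ℝ × ℝ) (L : List Piece) : ℝ :=
  periCost L (onlinePos σ L)

/-- Area of the bounding box of the packing produced by `σ` on `L`. -/
noncomputable def algArea (σ : List Piece → ℝ × ℝ) (L : List Piece) : ℝ :=
  areaCost L (onlinePos σ L)

/-! ### Rotations by 90° allowed -/

/-- The piece `p` in the orientation given by `r`: rotated by 90° if `r` is
`true`. -/
def orient (p : Piece) (r : Bool) : Piece := if r then (p.2, p.1) else p

/-- `pos, rot` is a packing with rotations of the list `L` of pieces. -/
def IsRotPacking (L : List Piece) (pos : Fin L.length → ℝ × ℝ)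
    (rot : Fin L.length → Bool) : Prop :=
  ∀ i j : Fin L.length, i ≠ j →
    Disjoint (interior (placedRect (orient (L.get i) (rot i)) (pos i)))
             (interior (placedRect (orient (L.get j) (rot j)) (pos j)))

/-- The union of the placed (possibly rotated) rectangles. -/
def packedRotSet (L : List Piece) (pos : Fin L.length → ℝ × ℝ)
    (rot : Fin L.length → Bool) : Set (ℝ × ℝ) :=
  ⋃ i : Fin L.length, placedRect (orient (L.get i) (rot i)) (pos i)

/-- Perimeter of the bounding box of a packing with rotations. -/
noncomputable def periRotCost (L : List Piece) (pos : Fin L.length → ℝ × ℝ)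
    (rot : Fin L.length → Bool) : ℝ :=
  2 * (boxWidth (packedRotSet L pos rot) + boxHeight (packedRotSet L pos rot))

/-- Area of the bounding box of a packing with rotations. -/
noncomputable def areaRotCost (L : List Piece) (pos : Fin L.length → ℝ × ℝ)
    (rot : Fin L.length → Bool) : ℝ :=
  boxWidth (packedRotSet L pos rot) * boxHeight (packedRotSet L pos rot)

/-- Optimal offline bounding-box perimeter with rotations allowed. -/
noncomputable def optRotPeri (L : List Piece) : ℝ :=
  sInf { c | ∃ (pos : Fin L.length → ℝ × ℝ) (rot : Fin L.length → Bool),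
    IsRotPacking L pos rot ∧ periRotCost L pos rot = c }

/-- Optimal offline bounding-box area with rotations allowed. -/
noncomputable def optRotArea (L : List Piece) : ℝ :=
  sInf { c | ∃ (pos : Fin L.length → ℝ × ℝ) (rot : Fin L.length → Bool),
    IsRotPacking L pos rot ∧ areaRotCost L pos rot = c }

/-- The positions chosen by the online rotation strategy `σ` on the stream `L`. -/
def onlineRotPos (σ : List Piece → (ℝ × ℝ) × Bool) (L : List Piece) :
    Fin L.length → ℝ × ℝ :=
  fun i => (σ (L.take ((i : ℕ) + 1))).1

/-- The orientations chosen by the online rotation strategy `σ` on the stream `L`. -/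
def onlineRot (σ : List Piece → (ℝ × ℝ) × Bool) (L : List Piece) :
    Fin L.length → Bool :=
  fun i => (σ (L.take ((i : ℕ) + 1))).2

/-- `σ` is a valid online rotation strategy: on every stream of pieces it
produces a packing with rotations. -/
def RotStrategyValid (σ : List Piece → (ℝ × ℝ) × Bool) : Prop :=
  ∀ L : List Piece, (∀ p ∈ L, PiecePos p) →
    IsRotPacking L (onlineRotPos σ L) (onlineRot σ L)

/-- Perimeter of the bounding box of the packing produced by `σ` on `L`. -/
noncomputable def algRotPeri (σ : List Piece → (ℝ × ℝ) × Bool) (L : List Piece) : ℝ :=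
  periRotCost L (onlineRotPos σ L) (onlineRot σ L)

/-- Area of the bounding box of the packing produced by `σ` on `L`. -/
noncomputable def algRotArea (σ : List Piece → (ℝ × ℝ) × Bool) (L : List Piece) : ℝ :=
  areaRotCost L (onlineRotPos σ L) (onlineRot σ L)

/-! ### Square pieces, bounding-square cost -/

/-- The axis-parallel closed square of side `s` placed at the point `q`. -/
def placedSq (s : ℝ) (q : ℝ × ℝ) : Set (ℝ × ℝ) :=
  Set.Icc q.1 (q.1 + s) ×ˢ Set.Icc q.2 (q.2 + s)

/-- `pos` is a packing of the list `L` of square pieces. -/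
def IsSqPacking (L : List ℝ) (pos : Fin L.length → ℝ × ℝ) : Prop :=
  ∀ i j : Fin L.length, i ≠ j →
    Disjoint (interior (placedSq (L.get i) (pos i)))
             (interior (placedSq (L.get j) (pos j)))

/-- The union of the placed squares. -/
def packedSqSet (L : List ℝ) (pos : Fin L.length → ℝ × ℝ) : Set (ℝ × ℝ) :=
  ⋃ i : Fin L.length, placedSq (L.get i) (pos i)

/-- Area of the smallest axis-parallel square containing all placed squares. -/
noncomputable def sqCost (L : List ℝ) (pos : Fin L.length → ℝ × ℝ) : ℝ :=
  (max (boxWidth (packedSqSet L pos)) (boxHeight (packedSqSet L pos))) ^ 2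

/-- Optimal offline bounding-square area for the square pieces of `L`. -/
noncomputable def optSq (L : List ℝ) : ℝ :=
  sInf { c | ∃ pos : Fin L.length → ℝ × ℝ, IsSqPacking L pos ∧ sqCost L pos = c }

/-- The positions chosen by the online strategy `σ` on the stream `L` of
square pieces. -/
def onlineSqPos (σ : List ℝ → ℝ × ℝ) (L : List ℝ) : Fin L.length → ℝ × ℝ :=
  fun i => σ (L.take ((i : ℕ) + 1))

/-- `σ` is a valid online translation strategy for square pieces. -/
def SqStrategyValid (σ : List ℝ → ℝ × ℝ) : Prop :=
  ∀ L : List ℝ, (∀ s ∈ L, 0 < s) → IsSqPacking L (onlineSqPos σ L)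

/-- Bounding-square area of the packing produced by `σ` on `L`. -/
noncomputable def algSq (σ : List ℝ → ℝ × ℝ) (L : List ℝ) : ℝ :=
  sqCost L (onlineSqPos σ L)

theorem interior_placedRect (p : Piece) (q : ℝ × ℝ) :
    interior (placedRect p q) = Ioo q.1 (q.1 + p.1) ×ˢ Ioo q.2 (q.2 + p.2) := by
  rw [placedRect, interior_prod_eq, interior_Icc, interior_Icc]

theorem disjoint_interior_placedRect_of_le {p p' : Piece} {q q' : ℝ × ℝ}
    (h : q.1 + p.1 ≤ q'.1 ∨ q'.1 + p'.1 ≤ q.1 ∨ q.2 + p.2 ≤ q'.2 ∨ q'.2 + p'.2 ≤ q.2) :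
    Disjoint (interior (placedRect p q)) (interior (placedRect p' q')) := by
  rw [interior_placedRect, interior_placedRect, Set.disjoint_left]
  rintro z ⟨⟨h₁, h₂⟩, h₃, h₄⟩ ⟨⟨h₅, h₆⟩, h₇, h₈⟩
  rcases h with h | h | h | h <;> linarith

theorem one_le_abs_sub_of_disjoint_unit {q q' : ℝ × ℝ}
    (h : Disjoint (interior (placedRect (1, 1) q)) (interior (placedRect (1, 1) q'))) :
    1 ≤ |q.1 - q'.1| ∨ 1 ≤ |q.2 - q'.2| := by
  by_contra! hc
  obtain ⟨⟨h₁, h₂⟩, h₃, h₄⟩ := And.imp abs_lt.mp abs_lt.mp hc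
  rw [interior_placedRect, interior_placedRect, Set.disjoint_left] at h
  refine h (a := ((q.1 + q'.1 + 1) / 2, (q.2 + q'.2 + 1) / 2)) ?_ ?_ <;>
    refine ⟨⟨?_, ?_⟩, ?_, ?_⟩ <;> dsimp only <;> linarith

theorem isCompact_packedSet (L : List Piece) (pos : Fin L.length → ℝ × ℝ) :
    IsCompact (packedSet L pos) :=
  isCompact_iUnion fun _ => isCompact_Icc.prod isCompact_Icc

theorem sub_le_boxWidth {S : Set (ℝ × ℝ)} (hS : IsCompact S) {a b : ℝ × ℝ}
    (ha : a ∈ S) (hb : b ∈ S) : a.1 - b.1 ≤ boxWidth S :=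
  have h := hS.image continuous_fst
  sub_le_sub (le_csSup h.bddAbove (mem_image_of_mem _ ha))
    (csInf_le h.bddBelow (mem_image_of_mem _ hb))

theorem sub_le_boxHeight {S : Set (ℝ × ℝ)} (hS : IsCompact S) {a b : ℝ × ℝ}
    (ha : a ∈ S) (hb : b ∈ S) : a.2 - b.2 ≤ boxHeight S :=
  have h := hS.image continuous_snd
  sub_le_sub (le_csSup h.bddAbove (mem_image_of_mem _ ha))
    (csInf_le h.bddBelow (mem_image_of_mem _ hb))

theorem boxWidth_nonneg {S : Set (ℝ × ℝ)} (hS : IsCompact S) : 0 ≤ boxWidth S :=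
  have h := hS.image continuous_fst
  sub_nonneg.mpr (Real.sInf_le_sSup _ h.bddBelow h.bddAbove)

theorem boxHeight_nonneg {S : Set (ℝ × ℝ)} (hS : IsCompact S) : 0 ≤ boxHeight S :=
  have h := hS.image continuous_snd
  sub_nonneg.mpr (Real.sInf_le_sSup _ h.bddBelow h.bddAbove)

theorem areaCost_nonneg (L : List Piece) (pos : Fin L.length → ℝ × ℝ) : 0 ≤ areaCost L pos :=
  mul_nonneg (boxWidth_nonneg (isCompact_packedSet L pos))
    (boxHeight_nonneg (isCompact_packedSet L pos))

theorem boxWidth_le {S : Set (ℝ × ℝ)} (hne : S.Nonempty) {W H : ℝ}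
    (h : S ⊆ Icc 0 W ×ˢ Icc 0 H) : boxWidth S ≤ W := by
  have h₁ : sSup (Prod.fst '' S) ≤ W :=
    csSup_le (hne.image _) (forall_mem_image.mpr fun _ hz => (h hz).1.2)
  have h₂ : 0 ≤ sInf (Prod.fst '' S) :=
    le_csInf (hne.image _) (forall_mem_image.mpr fun _ hz => (h hz).1.1)
  unfold boxWidth
  linarith

theorem boxHeight_le {S : Set (ℝ × ℝ)} (hne : S.Nonempty) {W H : ℝ}
    (h : S ⊆ Icc 0 W ×ˢ Icc 0 H) : boxHeight S ≤ H := by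
  have h₁ : sSup (Prod.snd '' S) ≤ H :=
    csSup_le (hne.image _) (forall_mem_image.mpr fun _ hz => (h hz).2.2)
  have h₂ : 0 ≤ sInf (Prod.snd '' S) :=
    le_csInf (hne.image _) (forall_mem_image.mpr fun _ hz => (h hz).2.1)
  unfold boxHeight
  linarith

/-- Any packing inside `[0, W] × [0, H]` bounds the optimal area by `W * H`. -/
theorem optArea_le_of_subset {L : List Piece} {pos : Fin L.length → ℝ × ℝ}
    (hpack : IsPacking L pos) (hne : (packedSet L pos).Nonempty) {W H : ℝ}
    (h : packedSet L pos ⊆ Icc 0 W ×ˢ Icc 0 H) : optArea L ≤ W * H := by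
  have hc := isCompact_packedSet L pos
  calc optArea L ≤ areaCost L pos :=
        csInf_le ⟨0, by rintro c ⟨pos', -, rfl⟩; exact areaCost_nonneg L pos'⟩ ⟨pos, hpack, rfl⟩
    _ ≤ W * H := mul_le_mul (boxWidth_le hne h) (boxHeight_le hne h) (boxHeight_nonneg hc)
        ((boxWidth_nonneg hc).trans (boxWidth_le hne h))

/-- Points of the plane at pairwise sup-distance at least `1`: among `n ^ 2` of them, two differ
by at least `n - 1` in one coordinate. -/
theorem exists_sub_ge_of_separated {n : ℕ} (hn : 1 ≤ n) (q : ℕ → ℝ × ℝ)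
    (hq : ∀ i < n ^ 2, ∀ j < n ^ 2, i ≠ j →
      1 ≤ |(q i).1 - (q j).1| ∨ 1 ≤ |(q i).2 - (q j).2|) :
    ∃ i < n ^ 2, ∃ j < n ^ 2,
      (n : ℝ) ≤ (q i).1 + 1 - (q j).1 ∨ (n : ℝ) ≤ (q i).2 + 1 - (q j).2 := by
  by_contra! hc
  obtain ⟨m, rfl⟩ : ∃ m, n = m + 1 := ⟨n - 1, by omega⟩
  have hne : (Finset.range ((m + 1) ^ 2)).Nonempty := ⟨0, by simp⟩
  obtain ⟨a, ha, hamin⟩ := Finset.exists_min_image _ (fun i => (q i).1) hne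
  obtain ⟨b, hb, hbmin⟩ := Finset.exists_min_image _ (fun i => (q i).2) hne
  simp only [Finset.mem_range] at ha hamin hb hbmin
  push_cast at hc
  obtain ⟨i, hi, j, hj, hij, hf⟩ := Finset.exists_ne_map_eq_of_card_lt_of_maps_to
    (s := Finset.range ((m + 1) ^ 2)) (t := Finset.range m ×ˢ Finset.range m)
    (f := fun i => (⌊(q i).1 - (q a).1⌋₊, ⌊(q i).2 - (q b).2⌋₊))
    (by
      rw [Finset.card_product, Finset.card_range, Finset.card_range]
      nlinarith)
    (by
      intro i hi
      have hi' : i < (m + 1) ^ 2 := by simpa using hi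
      have h₁ := (hc i hi' a ha).1
      have h₂ := (hc i hi' b hb).2
      have h₃ := hamin i hi'
      have h₄ := hbmin i hi'
      simp only [Finset.coe_product, Finset.coe_range, Set.mem_prod, Set.mem_Iio]
      exact ⟨(Nat.floor_lt (by linarith)).mpr (by linarith),
        (Nat.floor_lt (by linarith)).mpr (by linarith)⟩)
  rw [Finset.mem_range] at hi hj
  obtain ⟨hf₁, hf₂⟩ := Prod.mk.inj hf
  have key : ∀ {u v : ℝ}, 0 ≤ u → 0 ≤ v → ⌊u⌋₊ = ⌊v⌋₊ → |u - v| < 1 := by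
    intro u v hu hv huv
    have h₁ := Nat.floor_le hu
    have h₂ := Nat.floor_le hv
    have h₃ := Nat.lt_floor_add_one u
    have h₄ := Nat.lt_floor_add_one v
    rw [huv] at h₁ h₃
    exact abs_lt.mpr ⟨by linarith, by linarith⟩
  have h₁ := key (sub_nonneg.mpr (hamin i hi)) (sub_nonneg.mpr (hamin j hj)) hf₁
  have h₂ := key (sub_nonneg.mpr (hbmin i hi)) (sub_nonneg.mpr (hbmin j hj)) hf₂
  rw [sub_sub_sub_cancel_right] at h₁ h₂
  rcases hq i hi j hj hij with h | h <;> linarith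

/-- The stream of `N` unit squares followed by the piece `b`. -/
def unitsThen (N : ℕ) (b : Piece) : List Piece := List.replicate N (1, 1) ++ [b]

theorem length_unitsThen (N : ℕ) (b : Piece) : (unitsThen N b).length = N + 1 := by
  simp [unitsThen]

theorem get_unitsThen_of_lt {N : ℕ} {b : Piece} {i : Fin (unitsThen N b).length}
    (hi : (i : ℕ) < N) : (unitsThen N b).get i = (1, 1) := by
  rw [List.get_eq_getElem]
  simp [unitsThen, hi]

theorem get_unitsThen_of_not_lt {N : ℕ} {b : Piece} {i : Fin (unitsThen N b).length}
    (hi : ¬ (i : ℕ) < N) : (unitsThen N b).get i = b := by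
  rw [List.get_eq_getElem]
  simp [unitsThen, List.getElem_append, hi]

theorem one_le_of_mem_unitsThen {N : ℕ} {b : Piece} (hb : 1 ≤ b.1 ∧ 1 ≤ b.2) :
    ∀ p ∈ unitsThen N b, 1 ≤ p.1 ∧ 1 ≤ p.2 := by
  intro p hp
  rcases List.mem_append.mp hp with h | h
  · simp [List.eq_of_mem_replicate h]
  · rwa [List.mem_singleton.mp h]

theorem onlinePos_unitsThen_of_lt (σ : List Piece → ℝ × ℝ) {N : ℕ} {b : Piece}
    {i : Fin (unitsThen N b).length} (hi : (i : ℕ) < N) :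
    onlinePos σ (unitsThen N b) i = σ (List.replicate (i + 1) (1, 1)) := by
  have h : (i : ℕ) + 1 ≤ N := hi
  simp [onlinePos, unitsThen, List.take_append, h, List.take_replicate, Nat.sub_eq_zero_of_le h]

theorem mem_packedSet_unitsThen_of_lt (σ : List Piece → ℝ × ℝ) {N : ℕ} (b : Piece) {i : ℕ}
    (hi : i < N) {z : ℝ × ℝ}
    (hz : z ∈ placedRect (1, 1) (σ (List.replicate (i + 1) (1, 1)))) :
    z ∈ packedSet (unitsThen N b) (onlinePos σ (unitsThen N b)) := by
  refine mem_iUnion.mpr ⟨⟨i, by rw [length_unitsThen]; omega⟩, ?_⟩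
  rwa [get_unitsThen_of_lt hi, onlinePos_unitsThen_of_lt σ hi]

theorem exists_placedRect_subset_packedSet_unitsThen (N : ℕ) (b : Piece)
    (pos : Fin (unitsThen N b).length → ℝ × ℝ) :
    ∃ q, placedRect b q ⊆ packedSet (unitsThen N b) pos := by
  let i : Fin (unitsThen N b).length := ⟨N, by rw [length_unitsThen]; omega⟩
  refine ⟨pos i, ?_⟩
  have h := subset_iUnion (fun i => placedRect ((unitsThen N b).get i) (pos i)) i
  rwa [get_unitsThen_of_not_lt (i := i) (lt_irrefl N)] at h

theorem bottomLeft_mem_placedRect {p : Piece} (hp : 0 ≤ p.1 ∧ 0 ≤ p.2) (q : ℝ × ℝ) :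
    q ∈ placedRect p q :=
  ⟨⟨le_rfl, by linarith⟩, le_rfl, by linarith⟩

theorem topRight_mem_placedRect {p : Piece} (hp : 0 ≤ p.1 ∧ 0 ≤ p.2) (q : ℝ × ℝ) :
    q + p ∈ placedRect p q :=
  ⟨⟨by simpa using hp.1, le_rfl⟩, by simpa using hp.2, le_rfl⟩

/-- A packing of the stream that places the unit squares along `u` and the last piece at `r`. -/
theorem optArea_unitsThen_le {N : ℕ} {b r : ℝ × ℝ} (hb : 1 ≤ b.1 ∧ 1 ≤ b.2) {u : ℕ → ℝ × ℝ}
    {W H : ℝ}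
    (hu : ∀ i j, i < j → (u i).1 + 1 ≤ (u j).1 ∨ (u i).2 + 1 ≤ (u j).2)
    (hr : ∀ i, (u i).1 + 1 ≤ r.1 ∨ (u i).2 + 1 ≤ r.2)
    (hu₀ : ∀ i < N, placedRect (1, 1) (u i) ⊆ Icc 0 W ×ˢ Icc 0 H)
    (hr₀ : placedRect b r ⊆ Icc 0 W ×ˢ Icc 0 H) :
    optArea (unitsThen N b) ≤ W * H := by
  let pos : Fin (unitsThen N b).length → ℝ × ℝ := fun i => if (i : ℕ) < N then u i else r
  refine optArea_le_of_subset (pos := pos) ?_ ?_ ?_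
  · intro i j hij
    have hij' : (i : ℕ) ≠ j := fun h => hij (Fin.ext h)
    have hi := i.isLt.trans_eq (length_unitsThen N b)
    have hj := j.isLt.trans_eq (length_unitsThen N b)
    apply disjoint_interior_placedRect_of_le
    by_cases h₁ : (i : ℕ) < N <;> by_cases h₂ : (j : ℕ) < N
    · simp only [pos, h₁, h₂, if_true, get_unitsThen_of_lt]
      rcases hij'.lt_or_gt with h | h
      · have := hu _ _ h
        tauto
      · have := hu _ _ h
        tauto
    · simp only [pos, h₁, h₂, if_true, if_false, get_unitsThen_of_lt h₁]
      have := hr i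
      tauto
    · simp only [pos, h₁, h₂, if_true, if_false, get_unitsThen_of_lt h₂]
      have := hr j
      tauto
    · omega
  · obtain ⟨q, hq⟩ := exists_placedRect_subset_packedSet_unitsThen N b pos
    exact ⟨q, hq (bottomLeft_mem_placedRect ⟨by linarith, by linarith⟩ q)⟩
  · refine iUnion_subset fun i => ?_
    by_cases h : (i : ℕ) < N
    · simpa only [pos, h, if_true, get_unitsThen_of_lt] using hu₀ i h
    · simpa only [pos, h, if_false, get_unitsThen_of_not_lt h] using hr₀

theorem placedRect_subset {p : Piece} {q : ℝ × ℝ} {W H : ℝ} (h₁ : 0 ≤ q.1) (h₂ : q.1 + p.1 ≤ W)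
    (h₃ : 0 ≤ q.2) (h₄ : q.2 + p.2 ≤ H) : placedRect p q ⊆ Icc 0 W ×ˢ Icc 0 H :=
  prod_mono (Icc_subset_Icc h₁ h₂) (Icc_subset_Icc h₃ h₄)

theorem optArea_unitsThen_tall_le {N : ℕ} (hN : 1 ≤ N) :
    optArea (unitsThen N (1, N)) ≤ 2 * N := by
  have hN' : (1 : ℝ) ≤ N := by exact_mod_cast hN
  refine optArea_unitsThen_le (u := fun i => (0, i)) (r := (1, 0)) ⟨le_rfl, hN'⟩
    (fun i j h => Or.inr (by dsimp only; exact_mod_cast h)) (fun i => Or.inl (by simp)) (fun i hi => ?_) ?_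
  · have : (i : ℝ) + 1 ≤ N := by exact_mod_cast hi
    exact placedRect_subset le_rfl (by norm_num) (Nat.cast_nonneg i) this
  · exact placedRect_subset zero_le_one (by norm_num) le_rfl (by simp)

theorem optArea_unitsThen_wide_le {N : ℕ} (hN : 1 ≤ N) :
    optArea (unitsThen N (N, 1)) ≤ N * 2 := by
  have hN' : (1 : ℝ) ≤ N := by exact_mod_cast hN
  refine optArea_unitsThen_le (u := fun i => (i, 0)) (r := (0, 1)) ⟨hN', le_rfl⟩
    (fun i j h => Or.inl (by dsimp only; exact_mod_cast h)) (fun i => Or.inr (by simp)) (fun i hi => ?_) ?_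
  · have : (i : ℝ) + 1 ≤ N := by exact_mod_cast hi
    exact placedRect_subset (Nat.cast_nonneg i) this le_rfl (by norm_num)
  · exact placedRect_subset le_rfl (by simp) zero_le_one (by norm_num)

theorem StrategyValid.separated {σ : List Piece → ℝ × ℝ} (hσ : StrategyValid σ) {i j : ℕ}
    (hij : i ≠ j) :
    1 ≤ |(σ (List.replicate (i + 1) (1, 1))).1 - (σ (List.replicate (j + 1) (1, 1))).1| ∨
      1 ≤ |(σ (List.replicate (i + 1) (1, 1))).2 - (σ (List.replicate (j + 1) (1, 1))).2| := by
  set N := max i j + 1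
  have hi : i < N := by omega
  have hj : j < N := by omega
  have hlen := length_unitsThen N (1, 1)
  have h := hσ (unitsThen N (1, 1))
    (fun p hp => by
      have := one_le_of_mem_unitsThen ⟨le_rfl, le_rfl⟩ p hp
      exact ⟨by linarith, by linarith⟩)
    ⟨i, by omega⟩ ⟨j, by omega⟩ (by simpa using hij)
  rw [get_unitsThen_of_lt hi, get_unitsThen_of_lt hj, onlinePos_unitsThen_of_lt σ hi,
    onlinePos_unitsThen_of_lt σ hj] at h
  exact one_le_abs_sub_of_disjoint_unit h

/-- For every valid online translation strategy `σ` and every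
integer `n ≥ 1`, there exists a stream `L` of `n² + 1` pieces, each with both
edge lengths at least 1, such that `OPT(L) ≤ 2n²` and `ALG_σ(L) ≥ n³` (area
of the bounding box). -/
theorem area_translation_sqrt_opt_lower_bound
    (σ : List Piece → ℝ × ℝ) (hσ : StrategyValid σ) (n : ℕ) (hn : 1 ≤ n) :
    ∃ L : List Piece, L.length = n ^ 2 + 1 ∧ (∀ q ∈ L, 1 ≤ q.1 ∧ 1 ≤ q.2) ∧
      optArea L ≤ 2 * (n : ℝ) ^ 2 ∧ (n : ℝ) ^ 3 ≤ algArea σ L := by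
  have hn₂ : 1 ≤ n ^ 2 := Nat.one_le_pow _ _ hn
  have hn₂' : (1 : ℝ) ≤ (n ^ 2 : ℕ) := by exact_mod_cast hn₂
  have hcube : (n : ℝ) ^ 3 = n * (n ^ 2 : ℕ) := by push_cast; ring
  have hunit : (0 : ℝ) ≤ ((1, 1) : Piece).1 ∧ (0 : ℝ) ≤ ((1, 1) : Piece).2 := by norm_num
  obtain ⟨i, hi, j, hj, h | h⟩ := exists_sub_ge_of_separated hn
    (fun i => σ (List.replicate (i + 1) (1, 1))) (fun i _ j _ hij => hσ.separated hij)
  · have hb : 1 ≤ ((1, (n ^ 2 : ℕ)) : Piece).1 ∧ 1 ≤ ((1, (n ^ 2 : ℕ)) : Piece).2 :=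
      ⟨le_rfl, hn₂'⟩
    refine ⟨unitsThen (n ^ 2) (1, (n ^ 2 : ℕ)), length_unitsThen _ _, one_le_of_mem_unitsThen hb,
      by simpa using optArea_unitsThen_tall_le hn₂, ?_⟩
    have hc := isCompact_packedSet _ (onlinePos σ (unitsThen (n ^ 2) (1, (n ^ 2 : ℕ))))
    obtain ⟨q, hq⟩ := exists_placedRect_subset_packedSet_unitsThen (n ^ 2) (1, (n ^ 2 : ℕ))
      (onlinePos σ (unitsThen (n ^ 2) (1, (n ^ 2 : ℕ))))
    have hb' := And.imp zero_le_one.trans zero_le_one.trans hb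
    have hH := sub_le_boxHeight hc (hq (topRight_mem_placedRect hb' q))
      (hq (bottomLeft_mem_placedRect hb' q))
    have hW := sub_le_boxWidth hc
      (mem_packedSet_unitsThen_of_lt σ _ hi (topRight_mem_placedRect hunit _))
      (mem_packedSet_unitsThen_of_lt σ _ hj (bottomLeft_mem_placedRect hunit _))
    rw [Prod.snd_add, add_sub_cancel_left] at hH
    rw [hcube]
    exact mul_le_mul (h.trans hW) hH (Nat.cast_nonneg _) (boxWidth_nonneg hc)
  · have hb : 1 ≤ (((n ^ 2 : ℕ), 1) : Piece).1 ∧ 1 ≤ (((n ^ 2 : ℕ), 1) : Piece).2 :=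
      ⟨hn₂', le_rfl⟩
    refine ⟨unitsThen (n ^ 2) ((n ^ 2 : ℕ), 1), length_unitsThen _ _, one_le_of_mem_unitsThen hb,
      by simpa [mul_comm] using optArea_unitsThen_wide_le hn₂, ?_⟩
    have hc := isCompact_packedSet _ (onlinePos σ (unitsThen (n ^ 2) ((n ^ 2 : ℕ), 1)))
    obtain ⟨q, hq⟩ := exists_placedRect_subset_packedSet_unitsThen (n ^ 2) ((n ^ 2 : ℕ), 1)
      (onlinePos σ (unitsThen (n ^ 2) ((n ^ 2 : ℕ), 1)))
    have hb' := And.imp zero_le_one.trans zero_le_one.trans hb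
    have hW := sub_le_boxWidth hc (hq (topRight_mem_placedRect hb' q))
      (hq (bottomLeft_mem_placedRect hb' q))
    have hH := sub_le_boxHeight hc
      (mem_packedSet_unitsThen_of_lt σ _ hi (topRight_mem_placedRect hunit _))
      (mem_packedSet_unitsThen_of_lt σ _ hj (bottomLeft_mem_placedRect hunit _))
    rw [Prod.fst_add, add_sub_cancel_left] at hW
    rw [hcube, mul_comm]
    exact mul_le_mul hW (h.trans hH) (Nat.cast_nonneg _) (boxWidth_nonneg hc)
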